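/- Let 𝓓 = (Ω, 𝓑) be a supersimple 2-(n,4,λ) design, ∞ ∈ Ω, and suppose G = π_∞(𝓓) is transitive on Ω \ {∞} and preserves a system of imprimitivity with ℓ blocks each of size k. Then k ≤ 3λ + 1. -/

import Mathlib

open Equiv

variable {Ω : Type*} [DecidableEq Ω] [Fintype Ω]

/-- Two points of a 4-hypergraph are collinear if they are equal or some line contains both. -/
def HGCollinear (B : Finset (Finset Ω)) (x y : Ω) : Prop :=
  x = y ∨ ∃ b ∈ B, x ∈ b ∧ y ∈ b

/-- A 4-hypergraph is pliable if any two lines sharing three pairwise distinct points are equal. -/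
def HGPliable (B : Finset (Finset Ω)) : Prop :=
  ∀ b₁ ∈ B, ∀ b₂ ∈ B, ∀ p q r : Ω, p ≠ q → p ≠ r → q ≠ r →
    p ∈ b₁ → q ∈ b₁ → r ∈ b₁ → p ∈ b₂ → q ∈ b₂ → r ∈ b₂ → b₁ = b₂

/-- `g` is the elementary move `[x,y]`: it interchanges `x` and `y`, interchanges the
remaining two points of every line through `x` and `y`, and fixes everything else.
For `x = y` it is the identity. -/
def IsElemMove (B : Finset (Finset Ω)) (x y : Ω) (g : Equiv.Perm Ω) : Prop :=
  (x = y ∧ g = 1) ∨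
  (x ≠ y ∧ (∃ b ∈ B, x ∈ b ∧ y ∈ b) ∧ g x = y ∧ g y = x ∧
    ∀ z : Ω, z ≠ x → z ≠ y →
      ((∀ b ∈ B, ¬(x ∈ b ∧ y ∈ b ∧ z ∈ b)) → g z = z) ∧
      (∀ b ∈ B, x ∈ b → y ∈ b → z ∈ b →
        ∀ w ∈ b, w ≠ x → w ≠ y → w ≠ z → g z = w))

/-- `g` is the move sequence `[a₀,…,a_k]` recorded by the list
(elementary moves applied left to right). -/
def IsMoveSeq (B : Finset (Finset Ω)) : List Ω → Equiv.Perm Ω → Prop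
  | [], _ => False
  | [_], g => g = 1
  | a :: b :: l, g => ∃ e h : Equiv.Perm Ω,
      IsElemMove B a b e ∧ IsMoveSeq B (b :: l) h ∧ g = h * e

/-- The puzzle set `𝓛_𝓓` of all move sequences. -/
def puzzleSet (B : Finset (Finset Ω)) : Set (Equiv.Perm Ω) :=
  { g | ∃ l : List Ω, IsMoveSeq B l g }

/-- The hole stabiliser `π_x(𝓓)`: all closed move sequences starting and ending at `x`. -/
def holeStab (B : Finset (Finset Ω)) (x : Ω) : Set (Equiv.Perm Ω) :=
  { g | ∃ l : List Ω, l.head? = some x ∧ l.getLast? = some x ∧ IsMoveSeq B l g }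

/-- `(Ω, B)` is a 2-(n,4,λ) design: lines have four points and every pair of distinct
points lies in exactly `lam` lines. -/
def IsTwoDesign (B : Finset (Finset Ω)) (lam : ℕ) : Prop :=
  (∀ b ∈ B, b.card = 4) ∧
  ∀ p q : Ω, p ≠ q → (B.filter fun b => p ∈ b ∧ q ∈ b).card = lam

/-- Supersimple: any two distinct lines meet in at most two points. -/
def HGSupersimple (B : Finset (Finset Ω)) : Prop :=
  ∀ b₁ ∈ B, ∀ b₂ ∈ B, b₁ ≠ b₂ → (b₁ ∩ b₂).card ≤ 2

/-- `x ∈ overline{a,c}`: `x` is `a`, `c`, or lies on a line containing both `a` and `c`. -/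
def HGLineClosure (B : Finset (Finset Ω)) (a c x : Ω) : Prop :=
  x = a ∨ x = c ∨ ∃ b ∈ B, a ∈ b ∧ c ∈ b ∧ x ∈ b

/-- A system of imprimitivity for the hole stabiliser `π_x` acting on `Ω \ {x}`,
with `ℓ` blocks each of size `k`. -/
def IsHoleBlockSystem (B : Finset (Finset Ω)) (x : Ω) (P : Finset (Finset Ω))
    (k ℓ : ℕ) : Prop :=
  P.card = ℓ ∧ 1 < k ∧ 1 < ℓ ∧ (∀ Δ ∈ P, Δ.card = k) ∧
  (∀ a : Ω, a ≠ x → ∃! Δ : Finset Ω, Δ ∈ P ∧ a ∈ Δ) ∧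
  (∀ Δ ∈ P, x ∉ Δ) ∧
  (∀ g ∈ holeStab B x, ∀ Δ ∈ P, Δ.image (⇑g) ∈ P)

/-- The graph of the elementary move `[p,q]`. -/
def ElemMoveRel {α : Type*} (B : Finset (Finset α)) (p q z w : α) : Prop :=
  (z = p ∧ w = q) ∨ (z = q ∧ w = p) ∨
  (z ≠ p ∧ z ≠ q ∧ (∀ b ∈ B, ¬(p ∈ b ∧ q ∈ b ∧ z ∈ b)) ∧ w = z) ∨
  (z ≠ p ∧ z ≠ q ∧ w ≠ p ∧ w ≠ q ∧ w ≠ z ∧ ∃ b ∈ B, p ∈ b ∧ q ∈ b ∧ z ∈ b ∧ w ∈ b)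

theorem HGSupersimple.pliable {α : Type*} [DecidableEq α]
    {B : Finset (Finset α)} (hss : HGSupersimple B) :
    HGPliable B := by
  intro b₁ h₁ b₂ h₂ p q r hpq hpr hqr hp₁ hq₁ hr₁ hp₂ hq₂ hr₂
  by_contra hne
  have hsub : ({p, q, r} : Finset α) ⊆ b₁ ∩ b₂ := by
    intro z hz
    simp only [Finset.mem_insert, Finset.mem_singleton] at hz
    rcases hz with rfl | rfl | rfl <;> simp [*]
  have hcard := Finset.card_le_card hsub
  rw [Finset.card_eq_three.mpr ⟨p, q, r, hpq, hpr, hqr, rfl⟩] at hcard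
  have := hss b₁ h₁ b₂ h₂ hne
  omega

theorem eq_of_mem_of_card_eq_four {α : Type*} [DecidableEq α]
    {b : Finset α} (hb : b.card = 4) {p q z w v : α}
    (hpq : p ≠ q) (hzp : z ≠ p) (hzq : z ≠ q) (hwp : w ≠ p) (hwq : w ≠ q) (hwz : w ≠ z)
    (hvp : v ≠ p) (hvq : v ≠ q) (hvz : v ≠ z)
    (hp : p ∈ b) (hq : q ∈ b) (hz : z ∈ b) (hw : w ∈ b) (hv : v ∈ b) : w = v := by
  by_contra hwv
  have hsub : ({p, q, z, w, v} : Finset α) ⊆ b := by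
    intro u hu
    simp only [Finset.mem_insert, Finset.mem_singleton] at hu
    rcases hu with rfl | rfl | rfl | rfl | rfl <;> assumption
  have hcard := Finset.card_le_card hsub
  rw [Finset.card_insert_of_notMem, Finset.card_insert_of_notMem,
    Finset.card_insert_of_notMem, Finset.card_insert_of_notMem, Finset.card_singleton] at hcard
  · omega
  all_goals
    simp only [Finset.mem_insert, Finset.mem_singleton]
    grind

theorem ElemMoveRel.symm {α : Type*}
    {B : Finset (Finset α)} {p q z w : α} (h : ElemMoveRel B p q z w) :
    ElemMoveRel B p q w z := by
  unfold ElemMoveRel at h ⊢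
  grind

theorem ElemMoveRel.unique {α : Type*} [DecidableEq α]
    {B : Finset (Finset α)} (h4 : ∀ b ∈ B, b.card = 4)
    (hpl : HGPliable B) {p q z w v : α} (hpq : p ≠ q)
    (hw : ElemMoveRel B p q z w) (hv : ElemMoveRel B p q z v) : w = v := by
  rcases hw with ⟨h1, h2⟩ | ⟨h1, h2⟩ | ⟨h1, h2, h3, h4⟩ |
    ⟨hzp, hzq, hwp, hwq, hwz, b, hb, hpb, hqb, hzb, hwb⟩ <;>
  rcases hv with ⟨h1', h2'⟩ | ⟨h1', h2'⟩ | ⟨h1', h2', h3', h4'⟩ |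
    ⟨_, _, hvp, hvq, hvz, c, hc, hpc, hqc, hzc, hvc⟩
  case inr.inr.inr.inr.inr.inr =>
    obtain rfl := hpl b hb c hc p q z hpq hzp.symm hzq.symm hpb hqb hzb hpc hqc hzc
    exact eq_of_mem_of_card_eq_four (h4 b hb) hpq hzp hzq hwp hwq hwz hvp hvq hvz
      hpb hqb hzb hwb hvc
  all_goals grind

theorem ElemMoveRel.exists_right {α : Type*} [DecidableEq α]
    {B : Finset (Finset α)} (h4 : ∀ b ∈ B, b.card = 4)
    (p q z : α) : ∃ w, ElemMoveRel B p q z w := by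
  by_cases hzp : z = p
  · exact ⟨q, Or.inl ⟨hzp, rfl⟩⟩
  by_cases hzq : z = q
  · exact ⟨p, Or.inr (Or.inl ⟨hzq, rfl⟩)⟩
  by_cases hl : ∀ b ∈ B, ¬(p ∈ b ∧ q ∈ b ∧ z ∈ b)
  · exact ⟨z, Or.inr (Or.inr (Or.inl ⟨hzp, hzq, hl, rfl⟩))⟩
  push Not at hl
  obtain ⟨b, hb, hpb, hqb, hzb⟩ := hl
  have hlt : ({p, q, z} : Finset α).card < b.card := by
    rw [h4 b hb]
    exact Finset.card_le_three.trans_lt (by norm_num)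
  obtain ⟨w, hwb, hw⟩ := Finset.exists_mem_notMem_of_card_lt_card hlt
  simp only [Finset.mem_insert, Finset.mem_singleton, not_or] at hw
  exact ⟨w, Or.inr (Or.inr (Or.inr
    ⟨hzp, hzq, hw.1, hw.2.1, hw.2.2, b, hb, hpb, hqb, hzb, hwb⟩))⟩

/-- Distinct collinear points of a pliable 4-hypergraph admit an elementary move. -/
theorem exists_isElemMove {α : Type*} [DecidableEq α]
    {B : Finset (Finset α)} (h4 : ∀ b ∈ B, b.card = 4)
    (hpl : HGPliable B) {p q : α} (hpq : p ≠ q) (hcol : ∃ b ∈ B, p ∈ b ∧ q ∈ b) :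
    ∃ g, IsElemMove B p q g := by
  choose f hf using ElemMoveRel.exists_right (B := B) h4 p q
  have hval : ∀ z w, ElemMoveRel B p q z w → f z = w := fun z w h =>
    ElemMoveRel.unique h4 hpl hpq (hf z) h
  have hinv : Function.Involutive f := fun z => hval _ _ (hf z).symm
  refine ⟨hinv.toPerm f, Or.inr ⟨hpq, hcol, hval _ _ (Or.inl ⟨rfl, rfl⟩),
    hval _ _ (Or.inr (Or.inl ⟨rfl, rfl⟩)), fun z hzp hzq => ⟨fun h => ?_, ?_⟩⟩⟩
  · exact hval _ _ (Or.inr (Or.inr (Or.inl ⟨hzp, hzq, h, rfl⟩)))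
  · intro b hb hpb hqb hzb w hwb hwp hwq hwz
    exact hval _ _ (Or.inr (Or.inr (Or.inr
      ⟨hzp, hzq, hwp, hwq, hwz, b, hb, hpb, hqb, hzb, hwb⟩)))

/-- The points other than `p` and `q` on the lines through `p` and `q`. -/
def lineResidue {α : Type*} [DecidableEq α] (B : Finset (Finset α)) (p q : α) : Finset α :=
  (B.filter fun b => p ∈ b ∧ q ∈ b).biUnion fun b => (b.erase p).erase q

theorem mem_lineResidue {α : Type*} [DecidableEq α] {B : Finset (Finset α)} {p q z : α} :
    z ∈ lineResidue B p q ↔ z ≠ p ∧ z ≠ q ∧ ∃ b ∈ B, p ∈ b ∧ q ∈ b ∧ z ∈ b := by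
  simp only [lineResidue, Finset.mem_biUnion, Finset.mem_filter, Finset.mem_erase]
  grind

theorem IsTwoDesign.card_lineResidue_le {α : Type*} [DecidableEq α]
    {B : Finset (Finset α)} {lam : ℕ}
    (hdes : IsTwoDesign B lam) {p q : α} (hpq : p ≠ q) :
    (lineResidue B p q).card ≤ lam * 2 := by
  rw [← hdes.2 p q hpq]
  refine Finset.card_biUnion_le_card_mul _ _ _ fun b hb => ?_
  obtain ⟨hb, hp, hq⟩ := Finset.mem_filter.mp hb
  rw [Finset.card_erase_of_mem (Finset.mem_erase.mpr ⟨hpq.symm, hq⟩),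
    Finset.card_erase_of_mem hp, hdes.1 b hb]

theorem IsTwoDesign.exists_line {α : Type*} [DecidableEq α] {B : Finset (Finset α)} {lam : ℕ}
    (hdes : IsTwoDesign B lam) (hlam : 0 < lam) {p q : α} (hpq : p ≠ q) :
    ∃ b ∈ B, p ∈ b ∧ q ∈ b := by
  rw [← hdes.2 p q hpq, Finset.card_pos] at hlam
  obtain ⟨b, hb⟩ := hlam
  exact ⟨b, Finset.mem_filter.mp hb⟩

theorem IsElemMove.apply_eq_self {α : Type*} [DecidableEq α]
    {B : Finset (Finset α)} {p q z : α} {g : Equiv.Perm α}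
    (hg : IsElemMove B p q g) (hzp : z ≠ p) (hzq : z ≠ q) (hz : z ∉ lineResidue B p q) :
    g z = z := by
  rcases hg with ⟨-, rfl⟩ | ⟨-, -, -, -, h⟩
  · rfl
  · exact (h z hzp hzq).1 fun b hb hmem => hz (mem_lineResidue.mpr ⟨hzp, hzq, b, hb, hmem⟩)

theorem IsElemMove.apply_left {α : Type*} {B : Finset (Finset α)} {p q : α} {g : Equiv.Perm α}
    (hg : IsElemMove B p q g) : g p = q := by
  rcases hg with ⟨rfl, rfl⟩ | ⟨-, -, h, -⟩
  · rfl
  · exact h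

theorem IsElemMove.apply_right {α : Type*} {B : Finset (Finset α)} {p q : α} {g : Equiv.Perm α}
    (hg : IsElemMove B p q g) : g q = p := by
  rcases hg with ⟨rfl, rfl⟩ | ⟨-, -, -, h, -⟩
  · rfl
  · exact h

/-- If no line passes through `x`, `a` and `c`, the triangular move sequence `[x,a,c,x]`
interchanges `a` and `c` and fixes every point off the three line closures. -/
theorem exists_mem_holeStab_swap {α : Type*} [DecidableEq α]
    {B : Finset (Finset α)} {lam : ℕ} (hlam : 0 < lam)
    (hdes : IsTwoDesign B lam) (hpl : HGPliable B) {x a c : α} (hax : a ≠ x) (hcx : c ≠ x)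
    (hac : a ≠ c) (hc : c ∉ lineResidue B x a) :
    ∃ g ∈ holeStab B x, g a = c ∧ g c = a ∧ ∀ z, z ≠ x →
      z ∉ insert a (insert c (lineResidue B x a ∪ lineResidue B a c ∪ lineResidue B c x)) →
      g z = z := by
  obtain ⟨e₁, h₁⟩ := exists_isElemMove hdes.1 hpl hax.symm (hdes.exists_line hlam hax.symm)
  obtain ⟨e₂, h₂⟩ := exists_isElemMove hdes.1 hpl hac (hdes.exists_line hlam hac)
  obtain ⟨e₃, h₃⟩ := exists_isElemMove hdes.1 hpl hcx (hdes.exists_line hlam hcx)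
  have hx : x ∉ lineResidue B a c := by
    rw [mem_lineResidue] at hc ⊢
    grind
  have ha : a ∉ lineResidue B c x := by
    rw [mem_lineResidue] at hc ⊢
    grind
  refine ⟨1 * e₃ * e₂ * e₁, ⟨[x, a, c, x], rfl, rfl,
    e₁, _, h₁, ⟨e₂, _, h₂, ⟨e₃, 1, h₃, rfl, rfl⟩, rfl⟩, rfl⟩, ?_, ?_, ?_⟩
  · simp only [one_mul, Equiv.Perm.mul_apply]
    rw [h₁.apply_right, h₂.apply_eq_self hax.symm hcx.symm hx, h₃.apply_right]
  · simp only [one_mul, Equiv.Perm.mul_apply]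
    rw [h₁.apply_eq_self hcx hac.symm hc, h₂.apply_right, h₃.apply_eq_self hac hax ha]
  · intro z hzx hz
    simp only [Finset.mem_insert, Finset.mem_union, not_or] at hz
    obtain ⟨hza, hzc, ⟨hz₁, hz₂⟩, hz₃⟩ := hz
    simp only [one_mul, Equiv.Perm.mul_apply]
    rw [h₁.apply_eq_self hzx hza hz₁, h₂.apply_eq_self hza hzc hz₂,
      h₃.apply_eq_self hzc hzx hz₃]

/-- (Lemma 6.5) If the hole stabilizer of a supersimple 2-(n,4,λ)
design is transitive on `Ω \ {∞}` and preserves a system of imprimitivity with `ℓ`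
blocks of size `k`, then `k ≤ 3λ + 1`. -/
theorem stmt16 (B : Finset (Finset Ω)) (n lam : ℕ) (hn : Fintype.card Ω = n)
    (hlam : 0 < lam) (hdes : IsTwoDesign B lam) (hss : HGSupersimple B) (x : Ω)
    (htrans : ∀ a b : Ω, a ≠ x → b ≠ x → ∃ g ∈ holeStab B x, g a = b)
    (P : Finset (Finset Ω)) (k ℓ : ℕ) (hP : IsHoleBlockSystem B x P k ℓ) :
    k ≤ 3 * lam + 1 := by
  obtain ⟨hPl, hk, hl, hcard, huniq, hxP, hinv⟩ := hP
  obtain ⟨Δ, hΔ, Δ', hΔ', hne⟩ := Finset.one_lt_card.mp (hPl ▸ hl)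
  have hblock : ∀ Γ₁ ∈ P, ∀ Γ₂ ∈ P, ∀ z, z ∈ Γ₁ → z ∈ Γ₂ → Γ₁ = Γ₂ := by
    intro Γ₁ h₁ Γ₂ h₂ z hz₁ hz₂
    exact (huniq z fun h => hxP Γ₁ h₁ (h ▸ hz₁)).unique ⟨h₁, hz₁⟩ ⟨h₂, hz₂⟩
  obtain ⟨a, ha⟩ : Δ.Nonempty := Finset.card_pos.mp (by rw [hcard Δ hΔ]; omega)
  have hax : a ≠ x := fun h => hxP Δ hΔ (h ▸ ha)
  by_cases hsub : Δ' ⊆ lineResidue B x a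
  · have h₁ := Finset.card_le_card hsub
    have h₂ := hdes.card_lineResidue_le hax.symm
    rw [hcard Δ' hΔ'] at h₁
    omega
  obtain ⟨c, hcΔ', hc⟩ := Finset.not_subset.mp hsub
  have hcx : c ≠ x := fun h => hxP Δ' hΔ' (h ▸ hcΔ')
  have hac : a ≠ c := fun h => hne (hblock _ hΔ _ hΔ' a ha (h ▸ hcΔ'))
  obtain ⟨g, hg, hga, hgc, hfix⟩ :=
    exists_mem_holeStab_swap hlam hdes hss.pliable hax hcx hac hc
  have himg : Δ.image g = Δ' := hblock _ (hinv g hg Δ hΔ) _ hΔ' c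
    (Finset.mem_image.mpr ⟨a, ha, hga⟩) hcΔ'
  have himg' : Δ'.image g = Δ := hblock _ (hinv g hg Δ' hΔ') _ hΔ a
    (Finset.mem_image.mpr ⟨c, hcΔ', hgc⟩) ha
  have hmoved : Δ ∪ Δ' ⊆ insert a (insert c
      (lineResidue B x a ∪ lineResidue B a c ∪ lineResidue B c x)) := by
    intro z hz
    by_contra hzS
    rcases Finset.mem_union.mp hz with hz | hz
    · have hgz := hfix z (fun h => hxP Δ hΔ (h ▸ hz)) hzS
      exact hne (hblock _ hΔ _ hΔ' z hz (himg ▸ Finset.mem_image.mpr ⟨z, hz, hgz⟩))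
    · have hgz := hfix z (fun h => hxP Δ' hΔ' (h ▸ hz)) hzS
      exact hne (hblock _ hΔ _ hΔ' z (himg' ▸ Finset.mem_image.mpr ⟨z, hz, hgz⟩) hz)
  have hdisj : Disjoint Δ Δ' :=
    Finset.disjoint_left.mpr fun z h₁ h₂ => hne (hblock _ hΔ _ hΔ' z h₁ h₂)
  have hle := Finset.card_le_card hmoved
  rw [Finset.card_union_of_disjoint hdisj, hcard Δ hΔ, hcard Δ' hΔ'] at hle
  have h₁ := Finset.card_insert_le a (insert c
    (lineResidue B x a ∪ lineResidue B a c ∪ lineResidue B c x))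
  have h₂ := Finset.card_insert_le c
    (lineResidue B x a ∪ lineResidue B a c ∪ lineResidue B c x)
  have h₃ := Finset.card_union_le (lineResidue B x a ∪ lineResidue B a c) (lineResidue B c x)
  have h₄ := Finset.card_union_le (lineResidue B x a) (lineResidue B a c)
  have h₅ := hdes.card_lineResidue_le hax.symm
  have h₆ := hdes.card_lineResidue_le hac
  have h₇ := hdes.card_lineResidue_le hcx
  omega
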